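/- Let Λ be an Artin algebra such that the injective dimension of Λ as a left Λ-module is at most n and the injective dimension of Λ as a right Λ-module is at most n. Then every finitely generated injective left Λ-module has projective dimension at most n. In particular, the left regular module Λ is a cotilting left Λ-module. -/

import Mathlib

universe u

open CategoryTheory

/-- `ExtGrp Λ i M N` is the `i`-th Ext group `Ext^i_Λ(M, N)`, computed in the abelian
category of `Λ`-modules. Its vanishing is expressed as `Subsingleton (ExtGrp Λ i M N)`. -/
noncomputable abbrev ExtGrp (Λ : Type u) [Ring Λ] (i : ℕ) (M N : ModuleCat.{u} Λ) :
    Type u :=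
  ((Ext ℤ (ModuleCat.{u} Λ) i).obj (Opposite.op M)).obj N

/-- `ResolutionOfLength Λ D n M` : there is an exact sequence
`0 → X_n → ⋯ → X_1 → X_0 → M → 0` in `mod Λ` with all `X_i ∈ D`. -/
def ResolutionOfLength (Λ : Type u) [Ring Λ] (D : Set (ModuleCat.{u} Λ)) :
    ℕ → ModuleCat.{u} Λ → Prop
  | 0, M => ∃ X ∈ D, Nonempty ((X : Type u) ≃ₗ[Λ] (M : Type u))
  | n + 1, M => ∃ X ∈ D, ∃ (K : ModuleCat.{u} Λ) (f : K →ₗ[Λ] X) (g : X →ₗ[Λ] M),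
      Function.Injective f ∧ Function.Surjective g ∧ Function.Exact f g ∧
        ResolutionOfLength Λ D n K

/-- `ResdimLE Λ D k M` : the `D`-resolution dimension of `M` is at most `k`. -/
def ResdimLE (Λ : Type u) [Ring Λ] (D : Set (ModuleCat.{u} Λ)) (k : ℕ)
    (M : ModuleCat.{u} Λ) : Prop :=
  ∃ n ≤ k, ResolutionOfLength Λ D n M

/-- `AddClass Λ T` is `add T`, the class of direct summands of finite direct sums of
copies of `T`. -/
def AddClass (Λ : Type u) [Ring Λ] (T : ModuleCat.{u} Λ) : Set (ModuleCat.{u} Λ) :=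
  {M | ∃ (N : ModuleCat.{u} Λ) (r : ℕ),
    Nonempty ((↥M × ↥N) ≃ₗ[Λ] (Fin r → (T : Type u)))}

/-- `Perp Λ T` is `⊥T`, the class of finitely generated modules `M` with
`Ext^i_Λ(M, T) = 0` for all `i ≥ 1`. -/
def Perp (Λ : Type u) [Ring Λ] (T : ModuleCat.{u} Λ) : Set (ModuleCat.{u} Λ) :=
  {M | Module.Finite Λ M ∧ ∀ i : ℕ, 1 ≤ i → Subsingleton (ExtGrp Λ i M T)}

/-- `AddWedge Λ T` is `(add T)^∧`, the class of finitely generated modules of finite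
`add T`-resolution dimension. -/
def AddWedge (Λ : Type u) [Ring Λ] (T : ModuleCat.{u} Λ) : Set (ModuleCat.{u} Λ) :=
  {M | Module.Finite Λ M ∧ ∃ k : ℕ, ResdimLE Λ (AddClass Λ T) k M}

/-- `T` is a cotilting module: it is finitely generated, has finite injective
dimension, `Ext^i_Λ(T, T) = 0` for all `i ≥ 1`, and every finitely generated
injective module has finite `add T`-resolution dimension. -/
def IsCotilting (Λ : Type u) [Ring Λ] (T : ModuleCat.{u} Λ) : Prop :=
  Module.Finite Λ T ∧
  (∃ d : ℕ, ∀ (M : ModuleCat.{u} Λ) (j : ℕ), d < j → Subsingleton (ExtGrp Λ j M T)) ∧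
  (∀ i : ℕ, 1 ≤ i → Subsingleton (ExtGrp Λ i T T)) ∧
  (∀ I : ModuleCat.{u} Λ, Module.Finite Λ I → Module.Injective Λ I →
    ∃ k : ℕ, ResdimLE Λ (AddClass Λ T) k I)


theorem extGrp_subsingleton_iff {Λ : Type u} [Ring Λ] (M N : ModuleCat.{u} Λ) (j : ℕ) :
    Subsingleton (ExtGrp Λ (j+1) M N) ↔ Subsingleton (Abelian.Ext.{u} M N (j+1)) := by
  let P := ProjectiveResolution.of M
  have key1 : Subsingleton (ExtGrp Λ (j+1) M N) ↔
      ∀ f : P.complex.X (j+1) ⟶ N, P.complex.d (j+2) (j+1) ≫ f = 0 →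
        ∃ g : P.complex.X j ⟶ N, P.complex.d (j+1) j ≫ g = f := by
    rw [← ModuleCat.isZero_iff_subsingleton, (P.isoExt (R := ℤ) (j+1) N).isZero_iff,
      ← HomologicalComplex.exactAt_iff_isZero_homology,
      HomologicalComplex.exactAt_iff' _ j (j+1) (j+2) (by simp) (by simp),
      ShortComplex.moduleCat_exact_iff]
    rfl
  rw [key1]
  constructor
  · intro h
    refine ⟨fun a b => ?_⟩
    have : ∀ x : Abelian.Ext.{u} M N (j+1), x = 0 := by
      intro x
      obtain ⟨f, hf, rfl⟩ := P.extMk_surjective x (j+2) rfl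
      rw [P.extMk_eq_zero_iff f (j+2) rfl hf j rfl]
      exact h f hf
    rw [this a, this b]
  · intro h f hf
    rw [← P.extMk_eq_zero_iff f (j+2) rfl hf j rfl]
    exact Subsingleton.elim _ _

section shift
variable {S : Type u} [Ring S] {A B C : Type u} [AddCommGroup A] [Module S A]
  [AddCommGroup B] [Module S B] [AddCommGroup C] [Module S C]

theorem shortExact_of_maps (f : A →ₗ[S] B) (g : B →ₗ[S] C) (hf : Function.Injective f)
    (hg : Function.Surjective g) (h : Function.Exact f g) :
    (ShortComplex.mk (ModuleCat.ofHom f) (ModuleCat.ofHom g)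
      (by ext x; exact h.apply_apply_eq_zero x)).ShortExact :=
  ModuleCat.shortComplex_shortExact _ h hf hg

theorem ext_shift [Module.Projective S B] (f : A →ₗ[S] B) (g : B →ₗ[S] C)
    (hf : Function.Injective f)
    (hg : Function.Surjective g) (h : Function.Exact f g) (N : ModuleCat.{u} S) (j : ℕ)
    (hC : Subsingleton (Abelian.Ext.{u} (ModuleCat.of S C) N (j+2))) :
    Subsingleton (Abelian.Ext.{u} (ModuleCat.of S A) N (j+1)) := by
  have hS := shortExact_of_maps f g hf hg h
  have hP : Projective (ModuleCat.of S B) :=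
    (IsProjective.iff_projective _).1 inferInstance
  have : ∀ x : Abelian.Ext.{u} (ModuleCat.of S A) N (j+1), x = 0 := by
    intro x
    obtain ⟨y, hy⟩ := Abelian.Ext.contravariant_sequence_exact₁ hS N x (n₁ := j+2) (by omega)
      (Subsingleton.elim (α := Abelian.Ext.{u} (ModuleCat.of S C) N (j+2)) _ _)
    rw [← hy, Abelian.Ext.eq_zero_of_projective y]
    simp
  exact ⟨fun a b => by rw [this a, this b]⟩

theorem ext_extend (f : A →ₗ[S] B) (g : B →ₗ[S] C)
    (hf : Function.Injective f)
    (hg : Function.Surjective g) (h : Function.Exact f g) {N : Type u} [AddCommGroup N] [Module S N]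
    (hC : Subsingleton (Abelian.Ext.{u} (ModuleCat.of S C) (ModuleCat.of S N) 1))
    (φ : A →ₗ[S] N) : ∃ ψ : B →ₗ[S] N, ψ ∘ₗ f = φ := by
  have hS := shortExact_of_maps f g hf hg h
  obtain ⟨y, hy⟩ := Abelian.Ext.contravariant_sequence_exact₁ hS (ModuleCat.of S N)
      (Abelian.Ext.mk₀ (ModuleCat.ofHom φ)) (n₁ := 1) (by omega)
      (Subsingleton.elim (α := Abelian.Ext.{u} (ModuleCat.of S C) (ModuleCat.of S N) 1) _ _)
  obtain ⟨y, rfl⟩ := (Abelian.Ext.mk₀_bijective _ _).2 y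
  rw [Abelian.Ext.mk₀_comp_mk₀] at hy
  have := (Abelian.Ext.mk₀_bijective _ _).1 hy
  refine ⟨y.hom, ?_⟩
  have h2 := congrArg ModuleCat.Hom.hom this
  exact h2

end shift

section helpers
open Matrix MulOpposite

section mats
variable {Λ : Type u} [Ring Λ]

/-- Left multiplication by a matrix on column vectors, as a map of right modules. -/
def opMul {a b : ℕ} (D : Matrix (Fin a) (Fin b) Λ) :
    (Fin b → Λᵐᵒᵖ) →ₗ[Λᵐᵒᵖ] (Fin a → Λᵐᵒᵖ) where
  toFun w i := op ((D *ᵥ fun k => unop (w k)) i)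
  map_add' x y := by
    funext i
    apply unop_injective
    simp [mulVec, dotProduct, mul_add, Finset.sum_add_distrib]
  map_smul' c x := by
    funext i
    apply unop_injective
    simp [mulVec, dotProduct, Finset.sum_mul, mul_assoc]

theorem opMul_apply {a b : ℕ} (D : Matrix (Fin a) (Fin b) Λ) (w) (i) :
    opMul D w i = op ((D *ᵥ fun k => unop (w k)) i) := rfl

theorem opMul_eq_iff {a b : ℕ} (D : Matrix (Fin a) (Fin b) Λ) (w) (z) :
    opMul D w = z ↔ (D *ᵥ fun k => unop (w k)) = fun k => unop (z k) := by
  constructor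
  · rintro rfl; rfl
  · intro h
    funext i
    rw [opMul_apply, h, op_unop]

/-- A row vector as a functional on column vectors. -/
def opRow {b : ℕ} (v : Fin b → Λ) : (Fin b → Λᵐᵒᵖ) →ₗ[Λᵐᵒᵖ] Λᵐᵒᵖ where
  toFun w := op (v ⬝ᵥ fun k => unop (w k))
  map_add' x y := by
    apply unop_injective
    simp [dotProduct, mul_add, Finset.sum_add_distrib]
  map_smul' c x := by
    apply unop_injective
    simp [dotProduct, Finset.sum_mul, mul_assoc]

theorem opRow_apply {b : ℕ} (v : Fin b → Λ) (w) :
    opRow v w = op (v ⬝ᵥ fun k => unop (w k)) := rfl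

theorem exists_opRow {b : ℕ} (φ : (Fin b → Λᵐᵒᵖ) →ₗ[Λᵐᵒᵖ] Λᵐᵒᵖ) : ∃ v, φ = opRow v := by
  refine ⟨fun k => unop (φ (Pi.single k 1)), ?_⟩
  apply LinearMap.pi_ext'
  intro i
  ext
  apply unop_injective
  simp [opRow_apply, dotProduct, Pi.single_apply]

/-- Exactness of the sequence of right modules given by a sequence of matrices. -/
def IsExSeq (r : ℕ → ℕ) (D : ∀ j, Matrix (Fin (r j)) (Fin (r (j+1))) Λ) : Prop :=
  ∀ j c, D j *ᵥ c = 0 ↔ ∃ c', D (j+1) *ᵥ c' = c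

variable {r : ℕ → ℕ} {D : ∀ j, Matrix (Fin (r j)) (Fin (r (j+1))) Λ}

/-- The cokernel of the `j`-th map. -/
abbrev Cok (D : ∀ j, Matrix (Fin (r j)) (Fin (r (j+1))) Λ) (j : ℕ) : Type u :=
  (Fin (r j) → Λᵐᵒᵖ) ⧸ LinearMap.range (opMul (D j))

theorem IsExSeq.ker_eq (h : IsExSeq r D) (j : ℕ) :
    LinearMap.ker (opMul (D j)) = LinearMap.range (opMul (D (j+1))) := by
  ext w
  rw [LinearMap.mem_ker, opMul_eq_iff, LinearMap.mem_range]
  simp only [opMul_eq_iff]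
  refine (h j (fun k => unop (w k))).trans ⟨fun ⟨c, hc⟩ => ⟨fun k => op (c k), hc⟩,
    fun ⟨y, hy⟩ => ⟨_, hy⟩⟩

/-- The inclusion of the syzygy. -/
def cokMap (h : IsExSeq r D) (j : ℕ) : Cok D (j+1) →ₗ[Λᵐᵒᵖ] (Fin (r j) → Λᵐᵒᵖ) :=
  Submodule.liftQ _ (opMul (D j)) (h.ker_eq j).ge

theorem cokMap_injective (h : IsExSeq r D) (j : ℕ) : Function.Injective (cokMap h j) := by
  rw [← LinearMap.ker_eq_bot]
  exact Submodule.ker_liftQ_eq_bot _ _ _ (h.ker_eq j).le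

theorem cokMap_exact (h : IsExSeq r D) (j : ℕ) :
    Function.Exact (cokMap h j) (Submodule.mkQ (LinearMap.range (opMul (D j)))) := by
  rw [LinearMap.exact_iff, Submodule.ker_mkQ, cokMap, Submodule.range_liftQ]

theorem exactQ (n : ℕ) (hr : ∀ (M : ModuleCat.{u} Λᵐᵒᵖ) (j : ℕ), n < j →
      Subsingleton (ExtGrp Λᵐᵒᵖ j M (ModuleCat.of Λᵐᵒᵖ Λᵐᵒᵖ)))
    (h : IsExSeq r D) (j : ℕ) (hj : n ≤ j) (v : Fin (r (j+1)) → Λ) (hv : v ᵥ* D (j+1) = 0) :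
    ∃ w, w ᵥ* D j = v := by
  have ext : ∀ j i, n ≤ i + j → Subsingleton
      (Abelian.Ext.{u} (ModuleCat.of Λᵐᵒᵖ (Cok D j)) (ModuleCat.of Λᵐᵒᵖ Λᵐᵒᵖ) (i+1)) := by
    intro j
    induction j with
    | zero =>
      intro i hi
      rw [← extGrp_subsingleton_iff]
      exact hr _ _ (by omega)
    | succ j ih =>
      intro i hi
      exact ext_shift (cokMap h j) _ (cokMap_injective h j) (Submodule.mkQ_surjective _)
        (cokMap_exact h j) _ _ (ih (i+1) (by omega))
  have hle : LinearMap.range (opMul (D (j+1))) ≤ LinearMap.ker (opRow v) := by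
    rintro _ ⟨w, rfl⟩
    rw [LinearMap.mem_ker, opRow_apply]
    simp only [opMul_apply, unop_op]
    rw [dotProduct_mulVec, hv, zero_dotProduct, op_zero]
  obtain ⟨ψ, hψ⟩ := ext_extend (cokMap h j) _ (cokMap_injective h j)
    (Submodule.mkQ_surjective _) (cokMap_exact h j) (ext j 0 (by omega))
    (Submodule.liftQ _ (opRow v) hle)
  obtain ⟨w, rfl⟩ := exists_opRow ψ
  refine ⟨w, ?_⟩
  funext k
  have h1 := LinearMap.congr_fun hψ (Submodule.Quotient.mk (Pi.single k 1))
  have h2 : opRow w (opMul (D j) (Pi.single k 1)) = opRow v (Pi.single k 1) := h1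
  rw [opRow_apply, opRow_apply] at h2
  have h3 := op_injective h2
  simp only [opMul_apply, unop_op] at h3
  rw [dotProduct_mulVec] at h3
  have h4 : (fun i => unop ((Pi.single k 1 : Fin (r (j+1)) → Λᵐᵒᵖ) i)) = Pi.single k (1:Λ) := by
    funext i
    by_cases hi : i = k
    · subst hi; simp
    · simp [hi]
  rw [h4] at h3
  simpa using h3

/-- Vanishing of the homology of `Hom(Q, M)` at position `j+1`. -/
def Tz (D : ∀ j, Matrix (Fin (r j)) (Fin (r (j+1))) Λ) (j : ℕ) (M : Type u) [AddCommGroup M]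
    [Module Λ M] : Prop :=
  ∀ f : (Fin (r (j+1)) → Λ) →ₗ[Λ] M, f ∘ₗ (D j).vecMulLinear = 0 →
    ∃ g : (Fin (r (j+2)) → Λ) →ₗ[Λ] M, g ∘ₗ (D (j+1)).vecMulLinear = f

theorem vecMulLinear_comp (h : IsExSeq r D) (j : ℕ) :
    (D (j+1)).vecMulLinear ∘ₗ (D j).vecMulLinear = 0 := by
  have : D j * D (j+1) = 0 := by
    ext a k
    have := congrFun ((h j (D (j+1) *ᵥ Pi.single k 1)).2 ⟨_, rfl⟩) a
    rw [mulVec_mulVec] at this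
    simpa using this
  refine LinearMap.ext fun x => ?_
  simp [vecMul_vecMul, this]

theorem exists_matrix {a b : ℕ} (f : (Fin a → Λ) →ₗ[Λ] (Fin b → Λ)) :
    ∃ A : Matrix (Fin a) (Fin b) Λ, A.vecMulLinear = f := by
  refine ⟨LinearMap.toMatrixRight' f, ?_⟩
  exact LinearEquiv.symm_apply_apply LinearMap.toMatrixRight' f

theorem Tz_free (h : IsExSeq r D) (j m : ℕ) : Tz D j (Fin m → Λ) := by
  intro f hf
  obtain ⟨A, rfl⟩ := exists_matrix f
  have hA : D j * A = 0 := by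
    ext a k
    have := congrFun (LinearMap.congr_fun hf (Pi.single a 1)) k
    simp only [LinearMap.comp_apply, vecMulLinear_apply, vecMul_vecMul] at this
    simpa using this
  have : ∀ k, ∃ c, D (j+1) *ᵥ c = A.col k := by
    intro k
    rw [← h]
    funext a
    have := congrFun (congrFun hA a) k
    simpa [Matrix.mul_apply, mulVec, dotProduct] using this
  choose B hB using this
  refine ⟨(Matrix.of fun i k => B k i).vecMulLinear, ?_⟩
  refine LinearMap.ext fun x => ?_
  simp only [LinearMap.comp_apply, vecMulLinear_apply, vecMul_vecMul]
  congr 1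
  ext a k
  have := congrFun (hB k) a
  simpa [Matrix.mul_apply, mulVec, dotProduct] using this

theorem Tz_inj (n : ℕ) (hr : ∀ (M : ModuleCat.{u} Λᵐᵒᵖ) (j : ℕ), n < j →
      Subsingleton (ExtGrp Λᵐᵒᵖ j M (ModuleCat.of Λᵐᵒᵖ Λᵐᵒᵖ)))
    (h : IsExSeq r D) (j : ℕ) (hj : n ≤ j) (I : Type u) [AddCommGroup I] [Module Λ I]
    (hI : Module.Injective Λ I) : Tz D j I := by
  intro f hf
  have hle : LinearMap.ker (D (j+1)).vecMulLinear ≤ LinearMap.ker f := by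
    intro v hv
    obtain ⟨w, rfl⟩ := exactQ n hr h j hj v hv
    exact LinearMap.congr_fun hf w
  obtain ⟨g, hg⟩ := hI.out (Submodule.liftQ _ (D (j+1)).vecMulLinear le_rfl)
    (LinearMap.ker_eq_bot.1 (Submodule.ker_liftQ_eq_bot _ _ _ le_rfl))
    (Submodule.liftQ _ f hle)
  refine ⟨g, ?_⟩
  refine LinearMap.ext fun x => ?_
  exact hg (Submodule.Quotient.mk x)

theorem Tz_shift (h : IsExSeq r D) (j m : ℕ) (M : Type u) [AddCommGroup M] [Module Λ M]
    (p : (Fin m → Λ) →ₗ[Λ] M) (hp : Function.Surjective p) (hM : Tz D (j+1) M) :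
    Tz D j (LinearMap.ker p) := by
  intro f hf
  obtain ⟨g, hg⟩ := Tz_free h j m ((LinearMap.ker p).subtype ∘ₗ f) (by
    rw [LinearMap.comp_assoc, hf, LinearMap.comp_zero])
  obtain ⟨k, hk⟩ := hM (p ∘ₗ g) (by
    rw [LinearMap.comp_assoc, hg, ← LinearMap.comp_assoc, LinearMap.comp_ker_subtype,
      LinearMap.zero_comp])
  obtain ⟨k', rfl⟩ := Module.projective_lifting_property p k hp
  refine ⟨LinearMap.codRestrict _ (g - k' ∘ₗ (D (j+2)).vecMulLinear) ?_, ?_⟩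
  · intro x
    rw [LinearMap.mem_ker, LinearMap.sub_apply, map_sub, sub_eq_zero]
    exact (LinearMap.congr_fun hk x).symm
  · refine LinearMap.ext fun x => Subtype.ext ?_
    have h1 := LinearMap.congr_fun (vecMulLinear_comp h (j+1)) x
    have h2 := LinearMap.congr_fun hg x
    simp only [LinearMap.comp_apply, LinearMap.zero_apply] at h1 h2
    simp only [LinearMap.comp_apply, LinearMap.codRestrict_apply, LinearMap.sub_apply, h2,
      Submodule.subtype_apply]
    rw [h1, map_zero, sub_zero]

end mats

section seq
variable {Λ : Type u} [Ring Λ]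

theorem exists_next [IsNoetherianRing Λᵐᵒᵖ] {a b : ℕ} (D : Matrix (Fin a) (Fin b) Λ) :
    ∃ (t : ℕ) (D' : Matrix (Fin b) (Fin t) Λ), ∀ c, D *ᵥ c = 0 ↔ ∃ c', D' *ᵥ c' = c := by
  obtain ⟨t, s, hs⟩ := Submodule.fg_iff_exists_fin_generating_family.1
    (IsNoetherian.noetherian (LinearMap.ker (opMul D)))
  refine ⟨t, Matrix.of fun i k => unop (s k i), fun c => ?_⟩
  have h1 : D *ᵥ c = 0 ↔ (fun k => op (c k)) ∈ LinearMap.ker (opMul D) := by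
    rw [LinearMap.mem_ker, opMul_eq_iff]
    rfl
  rw [h1, ← hs, Submodule.mem_span_range_iff_exists_fun]
  have h2 : ∀ w : Fin t → Λᵐᵒᵖ, (∑ i, w i • s i = fun k => op (c k)) ↔
      (Matrix.of fun i k => unop (s k i)) *ᵥ (fun k => unop (w k)) = c := by
    intro w
    rw [funext_iff, funext_iff]
    refine forall_congr' fun i => ?_
    rw [← unop_injective.eq_iff]
    simp [mulVec, dotProduct]
  simp only [h2]
  exact ⟨fun ⟨w, hw⟩ => ⟨_, hw⟩, fun ⟨w, hw⟩ => ⟨fun k => op (w k), hw⟩⟩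

/-- A matrix together with its size. -/
structure MatS (Λ : Type u) where
  a : ℕ
  b : ℕ
  mat : Matrix (Fin a) (Fin b) Λ

/-- The next matrix of a free resolution. -/
noncomputable def nextS [IsNoetherianRing Λᵐᵒᵖ] (s : MatS Λ) : MatS Λ :=
  ⟨s.b, (exists_next s.mat).choose, (exists_next s.mat).choose_spec.choose⟩

/-- The free resolution starting from a matrix. -/
noncomputable def seqS [IsNoetherianRing Λᵐᵒᵖ] (s : MatS Λ) : ℕ → MatS Λ
  | 0 => s
  | j + 1 => nextS (seqS s j)

theorem seqS_exact [IsNoetherianRing Λᵐᵒᵖ] (s : MatS Λ) :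
    IsExSeq (fun j => (seqS s j).a) (fun j => (seqS s j).mat) := by
  intro j c
  exact (exists_next (seqS s j).mat).choose_spec.choose_spec c

/-- The modules whose relevant `Tor` groups vanish in degrees greater than `k`. -/
def TorLE (k : ℕ) (M : Type u) [AddCommGroup M] [Module Λ M] : Prop :=
  ∀ (r : ℕ → ℕ) (D : ∀ j, Matrix (Fin (r j)) (Fin (r (j+1))) Λ), IsExSeq r D →
    ∀ j, k ≤ j → Tz D j M

theorem torLE_zero_apply [IsNoetherianRing Λᵐᵒᵖ] (M : Type u)
    [AddCommGroup M] [Module Λ M] (hM : TorLE (Λ := Λ) 0 M) {t m : ℕ}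
    (D : Matrix (Fin t) (Fin m) Λ) (p : (Fin m → Λ) →ₗ[Λ] M) (hp : p ∘ₗ D.vecMulLinear = 0) :
    ∃ (b : ℕ) (d : (Fin m → Λ) →ₗ[Λ] (Fin b → Λ)) (g : (Fin b → Λ) →ₗ[Λ] M),
      d ∘ₗ D.vecMulLinear = 0 ∧ g ∘ₗ d = p := by
  have hs := seqS_exact (⟨t, m, D⟩ : MatS Λ)
  obtain ⟨g, hg⟩ := hM _ _ hs 0 le_rfl p hp
  exact ⟨_, _, g, vecMulLinear_comp hs 0, hg⟩

theorem projective_of_torLE [IsNoetherianRing Λ] [IsNoetherianRing Λᵐᵒᵖ] (M : Type u)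
    [AddCommGroup M] [Module Λ M] [Module.Finite Λ M] (hM : TorLE (Λ := Λ) 0 M) :
    Module.Projective Λ M := by
  obtain ⟨m, p, hp⟩ := Module.Finite.exists_fin' Λ M
  obtain ⟨t, q, hq⟩ := Module.Finite.exists_fin' Λ (LinearMap.ker p)
  obtain ⟨D, hD⟩ := exists_matrix ((LinearMap.ker p).subtype ∘ₗ q)
  obtain ⟨b, d, g, h0, hg⟩ := torLE_zero_apply M hM D p (by
    rw [hD, ← LinearMap.comp_assoc, LinearMap.comp_ker_subtype, LinearMap.zero_comp])
  have hle : LinearMap.ker p ≤ LinearMap.ker d := by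
    intro x hx
    obtain ⟨y, hy⟩ := hq ⟨x, hx⟩
    have h1 := LinearMap.congr_fun h0 y
    rw [hD] at h1
    simp only [LinearMap.comp_apply, hy] at h1
    exact h1
  let e := p.quotKerEquivOfSurjective hp
  let d' := (Submodule.liftQ _ _ hle) ∘ₗ e.symm.toLinearMap
  refine Module.Projective.of_split d' g ?_
  ext y
  obtain ⟨x, rfl⟩ := hp y
  have h1 : e.symm (p x) = Submodule.Quotient.mk x := by
    rw [LinearEquiv.symm_apply_eq]; rfl
  simp only [d', LinearMap.comp_apply, LinearEquiv.coe_coe, h1, LinearMap.id_apply]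
  exact LinearMap.congr_fun hg x

theorem mem_addClass_of_projective (M : ModuleCat.{u} Λ) [Module.Finite Λ M]
    [Module.Projective Λ M] : M ∈ AddClass Λ (ModuleCat.of Λ Λ) := by
  obtain ⟨m, p, hp⟩ := Module.Finite.exists_fin' Λ M
  obtain ⟨i, hi⟩ := Module.projective_lifting_property p LinearMap.id hp
  refine ⟨ModuleCat.of Λ (LinearMap.ker p), m, ⟨?_⟩⟩
  refine LinearEquiv.ofBijective (i.coprod (LinearMap.ker p).subtype) ⟨?_, ?_⟩
  · rw [← LinearMap.ker_eq_bot, LinearMap.ker_eq_bot']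
    rintro ⟨x, y⟩ h
    have h1 : i x + (y : Fin m → Λ) = 0 := h
    have h2 := congrArg p h1
    have h3 : p (i x) = x := LinearMap.congr_fun hi x
    rw [map_add, h3, LinearMap.mem_ker.1 y.2, add_zero, map_zero] at h2
    subst h2
    rw [map_zero, zero_add] at h1
    ext1
    · rfl
    · exact Subtype.ext h1
  · intro z
    have h3 : p (i (p z)) = p z := LinearMap.congr_fun hi (p z)
    refine ⟨(p z, ⟨z - i (p z), ?_⟩), ?_⟩
    · rw [LinearMap.mem_ker, map_sub, h3, sub_self]
    · change i (p z) + (z - i (p z)) = z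
      abel

theorem main_induction [IsNoetherianRing Λ] [IsNoetherianRing Λᵐᵒᵖ] (k : ℕ) :
    ∀ (M : ModuleCat.{u} Λ), Module.Finite Λ M → TorLE (Λ := Λ) k M →
      ResolutionOfLength Λ (AddClass Λ (ModuleCat.of Λ Λ)) k M ∧
      HasProjectiveDimensionLT M (k+1) := by
  induction k with
  | zero =>
    intro M hf hM
    have hP := projective_of_torLE (Λ := Λ) M hM
    refine ⟨⟨M, mem_addClass_of_projective M, ⟨LinearEquiv.refl _ _⟩⟩, ?_⟩
    have : Projective M := (IsProjective.iff_projective M).1 hP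
    infer_instance
  | succ k ih =>
    intro M hf hM
    obtain ⟨m, p, hp⟩ := Module.Finite.exists_fin' Λ M
    obtain ⟨h1, h2⟩ := ih (ModuleCat.of Λ (LinearMap.ker p))
      (inferInstanceAs (Module.Finite Λ (LinearMap.ker p)))
      (fun r D h j hj => Tz_shift h j m M p hp (hM r D h (j+1) (by omega)))
    have hex : Function.Exact (LinearMap.ker p).subtype p := LinearMap.exact_subtype_ker_map p
    constructor
    · refine ⟨ModuleCat.of Λ (Fin m → Λ), ?_, ModuleCat.of Λ (LinearMap.ker p),
        (LinearMap.ker p).subtype, p, Subtype.val_injective, hp, hex, h1⟩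
      have : Module.Finite Λ (ModuleCat.of Λ (Fin m → Λ)) :=
        inferInstanceAs (Module.Finite Λ (Fin m → Λ))
      have : Module.Projective Λ (ModuleCat.of Λ (Fin m → Λ)) :=
        inferInstanceAs (Module.Projective Λ (Fin m → Λ))
      exact mem_addClass_of_projective _
    · have hS := shortExact_of_maps (LinearMap.ker p).subtype p Subtype.val_injective hp hex
      refine (hS.hasProjectiveDimensionLT_X₃_iff k ?_).2 h2
      exact (IsProjective.iff_projective (R := Λ) (Fin m → Λ)).1 inferInstance

end seq

end helpers

/-!
The claim used in the proof of the final Corollary of Section 4 of the paper: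
if `Λ` is an Artin algebra whose injective dimension as a left `Λ`-module and as a
right `Λ`-module are both at most `n`, then every finitely generated injective left
`Λ`-module has projective dimension at most `n`; in particular the left regular
module `Λ` is a cotilting left `Λ`-module.
-/

theorem regular_module_cotilting_of_gorenstein
    {R : Type u} [CommRing R] [IsArtinianRing R]
    {Λ : Type u} [Ring Λ] [Algebra R Λ] [Module.Finite R Λ]
    (n : ℕ)
    -- `Λ` has injective dimension at most `n` as a left `Λ`-module:
    (hl : ∀ (M : ModuleCat.{u} Λ) (j : ℕ), n < j →
      Subsingleton (ExtGrp Λ j M (ModuleCat.of Λ Λ)))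
    -- `Λ` has injective dimension at most `n` as a right `Λ`-module:
    (hr : ∀ (M : ModuleCat.{u} Λᵐᵒᵖ) (j : ℕ), n < j →
      Subsingleton (ExtGrp Λᵐᵒᵖ j M (ModuleCat.of Λᵐᵒᵖ Λᵐᵒᵖ))) :
    -- every finitely generated injective left `Λ`-module has projective dimension ≤ n:
    (∀ I : ModuleCat.{u} Λ, Module.Finite Λ I → Module.Injective Λ I →
      ∀ (N : ModuleCat.{u} Λ) (j : ℕ), n < j → Subsingleton (ExtGrp Λ j I N)) ∧
    -- the left regular module is cotilting:
    IsCotilting Λ (ModuleCat.of Λ Λ) := by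
  have hRN : IsNoetherianRing R := inferInstance
  have hN : IsNoetherianRing Λ :=
    isNoetherian_of_tower R (inferInstance : IsNoetherian R Λ)
  have hN' : IsNoetherianRing Λᵐᵒᵖ := by
    have : Module.Finite R Λᵐᵒᵖ := Module.Finite.equiv (MulOpposite.opLinearEquiv R (M := Λ))
    exact isNoetherian_of_tower R (inferInstance : IsNoetherian R Λᵐᵒᵖ)
  have key : ∀ I : ModuleCat.{u} Λ, Module.Finite Λ I → Module.Injective Λ I →
      ResolutionOfLength Λ (AddClass Λ (ModuleCat.of Λ Λ)) n I ∧
      HasProjectiveDimensionLT I (n+1) := fun I hf hI =>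
    main_induction n I hf (fun r D h j hj => Tz_inj n hr h j hj I hI)
  refine ⟨?_, inferInstanceAs (Module.Finite Λ Λ), ⟨n, hl⟩, ?_, ?_⟩
  · intro I hf hI N j hj
    obtain ⟨j, rfl⟩ : ∃ i, j = i + 1 := ⟨j - 1, by omega⟩
    rw [extGrp_subsingleton_iff]
    have := (key I hf hI).2
    exact HasProjectiveDimensionLT.subsingleton I (n+1) (j+1) (by omega) N
  · intro i hi
    obtain ⟨i, rfl⟩ : ∃ k, i = k + 1 := ⟨i - 1, by omega⟩
    have : Projective (ModuleCat.of Λ Λ) := (IsProjective.iff_projective (R := Λ) Λ).1 inferInstance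
    rw [← ModuleCat.isZero_iff_subsingleton]
    exact isZero_Ext_succ_of_projective _ _ _
  · intro I hf hI
    exact ⟨n, n, le_rfl, (key I hf hI).1⟩
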